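/- Let α ∈ (0,1/2), let γ ≥ 0 be an integer, and let ε > 0. Then P(G(n, n^{−α}) contains an induced copy of W_a^γ for some integer a ≥ 1 with a + (γ+1)(4^a−1)/3 ≥ k_γ·f(n) + ε) → 0 as n → ∞. -/

import Mathlib

open Filter FirstOrder

noncomputable section

/-! ### The binomial random graph `G(n,p)` -/

/-- The number of edges of a simple graph. -/
noncomputable def edgeCt {n : ℕ} (G : SimpleGraph (Fin n)) : ℕ := Nat.card G.edgeSet

open scoped Classical in
/-- `prob n p Q` is the probability that the binomial random graph `G(n,p)` (on vertex set
`Fin n`) has property `Q`: the sum over all graphs `G` with `Q G` of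
`p^{e(G)} (1-p)^{n(n-1)/2 - e(G)}`. -/
noncomputable def prob (n : ℕ) (p : ℝ) (Q : SimpleGraph (Fin n) → Prop) : ℝ :=
  ∑ G : SimpleGraph (Fin n),
    if Q G then p ^ edgeCt G * (1 - p) ^ (n * (n - 1) / 2 - edgeCt G) else 0

/-- `expec n p W` is the expectation of a real-valued function `W` of the binomial random
graph `G(n,p)`. -/
noncomputable def expec (n : ℕ) (p : ℝ) (W : SimpleGraph (Fin n) → ℝ) : ℝ :=
  ∑ G : SimpleGraph (Fin n),
    W G * (p ^ edgeCt G * (1 - p) ^ (n * (n - 1) / 2 - edgeCt G))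

/-! ### The graphs `W_a^γ` and `W_a^{γ,*}` -/

/-- `ωr r a = (r^a − 1)/(r−1)`, the number of vertices of the perfect `r`-ary tree of
depth `a − 1`. -/
def ωr (r a : ℕ) : ℕ := (r ^ a - 1) / (r - 1)

/-- The depth of the node with (0-based) breadth-first (heap) index `j` in the infinite
`r`-ary tree: the root has index 0, and the parent of node `j ≥ 1` is node `(j−1)/r`. -/
def heapDepth (r : ℕ) : ℕ → ℕ
  | 0 => 0
  | j + 1 => heapDepth r (j / r) + 1
  decreasing_by exact Nat.lt_succ_of_le (Nat.div_le_self _ _)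

/-- The vertex set of `W_a^γ`: the path `F₁` on `a` vertices (`Sum.inl`), together with,
for each of the `(4^a−1)/3` vertices `i` of the perfect 4-ary tree `F₂` (in breadth-first
order), the vertex `(i,0)` of `F₂` itself and the `γ` inner vertices `(i,1),…,(i,γ)` of the
path `P_{γ+2}` joining `i` to the vertex of `F₁` at the same distance from the root. -/
abbrev WVert (γ a : ℕ) := Fin a ⊕ (Fin (ωr 4 a) × Fin (γ + 1))

/-- Base (directed) adjacency relation generating `W_a^γ`: consecutive `F₁`-vertices;
the last inner path vertex `(i,γ)` is joined to the `F₁`-vertex at depth of `i`;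
consecutive vertices along each `P_{γ+2}`; and tree edges of the perfect 4-ary tree
(in heap indexing, `j` is the parent of `i ≥ 1` iff `j = (i−1)/4`). -/
def Wbase (γ a : ℕ) : WVert γ a → WVert γ a → Prop
  | Sum.inl u, Sum.inl v => (v : ℕ) = (u : ℕ) + 1
  | Sum.inl u, Sum.inr iv => (iv.2 : ℕ) = γ ∧ heapDepth 4 (iv.1 : ℕ) = (u : ℕ)
  | Sum.inr _, Sum.inl _ => False
  | Sum.inr iv, Sum.inr jw =>
      (iv.1 = jw.1 ∧ (jw.2 : ℕ) = (iv.2 : ℕ) + 1) ∨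
      ((iv.2 : ℕ) = 0 ∧ (jw.2 : ℕ) = 0 ∧ 1 ≤ (iv.1 : ℕ) ∧ (jw.1 : ℕ) = ((iv.1 : ℕ) - 1) / 4)

/-- The graph `W_a^γ`. -/
def WG (γ a : ℕ) : SimpleGraph (WVert γ a) := SimpleGraph.fromRel (Wbase γ a)

/-- The vertex set of `W_a^{γ,*}` (with `ω₁ = ωr r a`, `ω₂ = ωr r ω₁`), as five pieces:
the path `F₁` on `a` vertices; the tree `F₂` together with the inner vertices of the
paths `P_{γ+2}` joining `F₂` to `F₁` (pairs `(i,k)`, `k = 0` being the `F₂`-vertex itself);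
the `γ` inner vertices of the paths `P_{γ+2}` joining the `i`-th vertex of `F₂` (in
breadth-first order) to the `i`-th vertex of the path `F̃₁`; the path `F̃₁` on `ω₁`
vertices; and the tree `F̃₂` together with the inner vertices of the paths `P_{γ+2}`
joining `F̃₂` to `F̃₁`. -/
abbrev WSVert (γ r a : ℕ) :=
  Fin a ⊕ ((Fin (ωr r a) × Fin (γ + 1)) ⊕ ((Fin (ωr r a) × Fin γ) ⊕
    (Fin (ωr r a) ⊕ (Fin (ωr r (ωr r a)) × Fin (γ + 1)))))

/-- Base (directed) adjacency relation generating `W_a^{γ,*}`. -/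
def WSbase (γ r a : ℕ) : WSVert γ r a → WSVert γ r a → Prop
  | .inl u, .inl v => (v : ℕ) = (u : ℕ) + 1
  | .inl u, .inr (.inl iv) => (iv.2 : ℕ) = γ ∧ heapDepth r (iv.1 : ℕ) = (u : ℕ)
  | .inr (.inl iv), .inr (.inl jw) =>
      (iv.1 = jw.1 ∧ (jw.2 : ℕ) = (iv.2 : ℕ) + 1) ∨
      ((iv.2 : ℕ) = 0 ∧ (jw.2 : ℕ) = 0 ∧ 1 ≤ (iv.1 : ℕ) ∧ (jw.1 : ℕ) = ((iv.1 : ℕ) - 1) / r)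
  | .inr (.inl iv), .inr (.inr (.inl jm)) => (iv.2 : ℕ) = 0 ∧ iv.1 = jm.1 ∧ (jm.2 : ℕ) = 0
  | .inr (.inl iv), .inr (.inr (.inr (.inl d))) => γ = 0 ∧ (iv.2 : ℕ) = 0 ∧ (iv.1 : ℕ) = (d : ℕ)
  | .inr (.inr (.inl im)), .inr (.inr (.inl jm)) => im.1 = jm.1 ∧ (jm.2 : ℕ) = (im.2 : ℕ) + 1
  | .inr (.inr (.inl im)), .inr (.inr (.inr (.inl d))) =>
      (im.2 : ℕ) + 1 = γ ∧ (im.1 : ℕ) = (d : ℕ)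
  | .inr (.inr (.inr (.inl d))), .inr (.inr (.inr (.inl e))) => (e : ℕ) = (d : ℕ) + 1
  | .inr (.inr (.inr (.inl d))), .inr (.inr (.inr (.inr jw))) =>
      (jw.2 : ℕ) = γ ∧ heapDepth r (jw.1 : ℕ) = (d : ℕ)
  | .inr (.inr (.inr (.inr iv))), .inr (.inr (.inr (.inr jw))) =>
      (iv.1 = jw.1 ∧ (jw.2 : ℕ) = (iv.2 : ℕ) + 1) ∨
      ((iv.2 : ℕ) = 0 ∧ (jw.2 : ℕ) = 0 ∧ 1 ≤ (iv.1 : ℕ) ∧ (jw.1 : ℕ) = ((iv.1 : ℕ) - 1) / r)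
  | _, _ => False

/-- The graph `W_a^{γ,*}`. -/
def WSG (γ r a : ℕ) : SimpleGraph (WSVert γ r a) := SimpleGraph.fromRel (WSbase γ r a)

/-- `Vnum γ r a = V_{γ,r}(a) = a + 2(γ+1)ω_r(a) + (γ+1)ω_r(ω_r(a))`,
the number of vertices of `W_a^{γ,*}`. -/
def Vnum (γ r a : ℕ) : ℕ := a + 2 * (γ + 1) * ωr r a + (γ + 1) * ωr r (ωr r a)

/-- `s` is (the vertex set of) an induced copy of `H` in `G`. -/
def IsInducedCopy {V W : Type} (H : SimpleGraph W) (G : SimpleGraph V) (s : Set V) : Prop :=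
  Nonempty (H ≃g G.induce s)

/-! ### The quantities `k_γ` and `f` -/

/-- `kcoef α γ = k_γ = 2(1 − α(γ+2)/(γ+1))`. -/
def kcoef (α : ℝ) (γ : ℕ) : ℝ := 2 * (1 - α * ((γ : ℝ) + 2) / ((γ : ℝ) + 1))

/-- `ff α x = f(x) = x^α · ln x`. -/
def ff (α x : ℝ) : ℝ := x ^ α * Real.log x

/-! ### The language `L_m` and EMSO satisfaction -/

/-- Relation symbols of the language `L_m`: `m` unary symbols and one binary symbol. -/
def LRel (m : ℕ) : ℕ → Type
  | 1 => Fin m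
  | 2 => Unit
  | _ => Empty

/-- The first-order language `L_m`: one binary relation symbol, `m` unary relation symbols
and no function symbols. -/
def Lang (m : ℕ) : Language where
  Functions := fun _ => Empty
  Relations := LRel m

/-- The `L_m`-structure on `Fin n` whose binary relation is adjacency in the graph `G` and
whose `i`-th unary relation is membership in `S i`. -/
def structOf {n m : ℕ} (G : SimpleGraph (Fin n)) (S : Fin m → Set (Fin n)) :
    (Lang m).Structure (Fin n) where
  funMap := fun f _ => Empty.elim f
  RelMap := fun {k} r v =>
    match k, r, v with
    | 1, i, v => v 0 ∈ S i
    | 2, _, v => G.Adj (v 0) (v 1)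
    | 0, r, _ => Empty.elim r
    | (_ + 3), r, _ => Empty.elim r

/-- `G` EMSO-satisfies the `L_m`-sentence `φ`: there are sets `S 0, …, S (m-1)` of vertices
such that the structure on `Fin n` given by adjacency in `G` and membership in the `S i`
satisfies `φ`. -/
def EMSOSat {n m : ℕ} (G : SimpleGraph (Fin n)) (φ : (Lang m).Sentence) : Prop :=
  ∃ S : Fin m → Set (Fin n),
    @FirstOrder.Language.Sentence.Realize (Lang m) (Fin n) (structOf G S) φ

/-! ### First moment bounds in `G(n,p)` -/

section FirstMoment

/-- The probability that `G(n,p)` equals a given graph. -/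
def graphWeight {n : ℕ} (p : ℝ) (G : SimpleGraph (Fin n)) : ℝ :=
  p ^ edgeCt G * (1 - p) ^ (n * (n - 1) / 2 - edgeCt G)

lemma graphWeight_nonneg {n : ℕ} {p : ℝ} (h0 : 0 ≤ p) (h1 : p ≤ 1) (G : SimpleGraph (Fin n)) :
    0 ≤ graphWeight p G :=
  mul_nonneg (pow_nonneg h0 _) (pow_nonneg (sub_nonneg.2 h1) _)

lemma prob_eq_sum_filter (n : ℕ) (p : ℝ) (Q : SimpleGraph (Fin n) → Prop) [DecidablePred Q] :
    prob n p Q = ∑ G with Q G, graphWeight p G := by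
  rw [prob, Finset.sum_filter]
  refine Finset.sum_congr rfl fun G _ => ?_
  congr 1

lemma prob_mono {n : ℕ} {p : ℝ} (h0 : 0 ≤ p) (h1 : p ≤ 1) {Q R : SimpleGraph (Fin n) → Prop}
    (h : ∀ G, Q G → R G) : prob n p Q ≤ prob n p R := by
  classical
  rw [prob_eq_sum_filter, prob_eq_sum_filter]
  exact Finset.sum_le_sum_of_subset_of_nonneg (Finset.monotone_filter_right _ fun G _ => h G) fun G _ _ =>
    graphWeight_nonneg h0 h1 G

lemma prob_nonneg {n : ℕ} {p : ℝ} (h0 : 0 ≤ p) (h1 : p ≤ 1) (Q : SimpleGraph (Fin n) → Prop) :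
    0 ≤ prob n p Q := by
  classical
  rw [prob_eq_sum_filter]
  exact Finset.sum_nonneg fun G _ => graphWeight_nonneg h0 h1 G

/-- Markov's inequality for the number of events from a finite family that occur. -/
lemma mul_prob_le_sum {ι : Type*} {n : ℕ} {p : ℝ} (h0 : 0 ≤ p) (h1 : p ≤ 1) (s : Finset ι)
    (Q : SimpleGraph (Fin n) → Prop) (R : ι → SimpleGraph (Fin n) → Prop) (M : ℕ)
    (h : ∀ G, Q G → ∃ t ⊆ s, M ≤ t.card ∧ ∀ i ∈ t, R i G) :
    M * prob n p Q ≤ ∑ i ∈ s, prob n p (R i) := by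
  classical
  simp only [prob_eq_sum_filter, Finset.sum_filter]
  rw [Finset.sum_comm, Finset.mul_sum]
  refine Finset.sum_le_sum fun G _ => ?_
  have hw := graphWeight_nonneg h0 h1 G
  rw [← Finset.sum_filter, Finset.sum_const, nsmul_eq_mul]
  split_ifs with hQ
  · obtain ⟨t, hts, hM, hR⟩ := h G hQ
    have hcard : M ≤ (s.filter fun i => R i G).card :=
      hM.trans (Finset.card_le_card fun i hi => Finset.mem_filter.2 ⟨hts hi, hR i hi⟩)
    exact mul_le_mul_of_nonneg_right (by exact_mod_cast hcard) hw
  · rw [mul_zero]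
    positivity

/-- Union bound over a finite set of events. -/
lemma prob_le_sum {ι : Type*} {n : ℕ} {p : ℝ} (h0 : 0 ≤ p) (h1 : p ≤ 1) (s : Finset ι)
    (Q : SimpleGraph (Fin n) → Prop) (R : ι → SimpleGraph (Fin n) → Prop)
    (h : ∀ G, Q G → ∃ i ∈ s, R i G) :
    prob n p Q ≤ ∑ i ∈ s, prob n p (R i) := by
  classical
  have := mul_prob_le_sum h0 h1 s Q R 1 fun G hG => by
    obtain ⟨i, hi, hR⟩ := h G hG
    exact ⟨{i}, by simpa using hi, by simp, by simpa using hR⟩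
  simpa using this

/-- The probability that the edges of `G(n,p)` inside a set `A` of pairs are exactly those
of `B`. -/
lemma prob_cylinder_le {n : ℕ} {p : ℝ} (h0 : 0 ≤ p) (h1 : p ≤ 1)
    (A B : Finset (Sym2 (Fin n))) (hBA : B ⊆ A) (hA : ∀ e ∈ A, ¬ e.IsDiag) :
    prob n p (fun G => ∀ e ∈ A, e ∈ G.edgeSet ↔ e ∈ B) ≤
      p ^ B.card * (1 - p) ^ (A.card - B.card) := by
  classical
  set E : Finset (Sym2 (Fin n)) := (⊤ : SimpleGraph (Fin n)).edgeFinset with hE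
  have hEcard : E.card = n * (n - 1) / 2 := by
    rw [hE, SimpleGraph.card_edgeFinset_top_eq_card_choose_two, Fintype.card_fin,
      Nat.choose_two_right]
  have hAE : A ⊆ E := fun e he => by simpa [hE] using hA e he
  have hedge : ∀ G : SimpleGraph (Fin n), G.edgeFinset ⊆ E := fun G =>
    SimpleGraph.edgeFinset_mono le_top
  have hsplit : ∀ G : SimpleGraph (Fin n), (∀ e ∈ A, e ∈ G.edgeSet ↔ e ∈ B) →
      G.edgeFinset = B ∪ (G.edgeFinset \ A) := by
    intro G hG
    ext e
    have := hG e
    have := @hBA e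
    simp only [Finset.mem_union, Finset.mem_sdiff, SimpleGraph.mem_edgeFinset]
    tauto
  have hweight : ∀ G : SimpleGraph (Fin n), (∀ e ∈ A, e ∈ G.edgeSet ↔ e ∈ B) →
      graphWeight p G = p ^ B.card * (1 - p) ^ (A.card - B.card) *
        (p ^ (G.edgeFinset \ A).card * (1 - p) ^ ((E \ A).card - (G.edgeFinset \ A).card)) := by
    intro G hG
    have hcard : edgeCt G = B.card + (G.edgeFinset \ A).card := by
      rw [edgeCt, Nat.card_eq_fintype_card, ← SimpleGraph.edgeFinset_card]
      conv_lhs => rw [hsplit G hG]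
      exact Finset.card_union_of_disjoint
        (Finset.disjoint_sdiff.mono_left hBA)
    have hle : (G.edgeFinset \ A).card ≤ (E \ A).card :=
      Finset.card_le_card (Finset.sdiff_subset_sdiff (hedge G) le_rfl)
    have hBle := Finset.card_le_card hBA
    have hEA := Finset.card_sdiff_add_card_eq_card hAE
    have hexp : n * (n - 1) / 2 - edgeCt G =
        (A.card - B.card) + ((E \ A).card - (G.edgeFinset \ A).card) := by
      rw [← hEcard, hcard]
      omega
    rw [graphWeight, hexp, hcard, pow_add, pow_add]
    ring
  rw [prob_eq_sum_filter,
    Finset.sum_congr rfl fun G hG => hweight G (Finset.mem_filter.1 hG).2, ← Finset.mul_sum]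
  refine mul_le_of_le_one_right
    (mul_nonneg (pow_nonneg h0 _) (pow_nonneg (sub_nonneg.2 h1) _)) ?_
  have htotal : ∑ t ∈ (E \ A).powerset, p ^ t.card * (1 - p) ^ ((E \ A).card - t.card) = 1 := by
    rw [Finset.sum_pow_mul_eq_add_pow]
    simp
  refine le_of_le_of_eq ?_ htotal
  have hinj : Set.InjOn (fun G : SimpleGraph (Fin n) => G.edgeFinset \ A)
      (Finset.univ.filter fun G : SimpleGraph (Fin n) => ∀ e ∈ A, e ∈ G.edgeSet ↔ e ∈ B) := by
    intro G hG G' hG' h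
    have hG := (Finset.mem_filter.1 hG).2
    have hG' := (Finset.mem_filter.1 hG').2
    refine SimpleGraph.edgeFinset_inj.1 ?_
    rw [hsplit G hG, hsplit G' hG']
    exact congrArg (B ∪ ·) h
  rw [← Finset.sum_image (f := fun t : Finset (Sym2 (Fin n)) =>
    p ^ t.card * (1 - p) ^ ((E \ A).card - t.card)) hinj]
  refine Finset.sum_le_sum_of_subset_of_nonneg ?_ fun t _ _ =>
    mul_nonneg (pow_nonneg h0 _) (pow_nonneg (sub_nonneg.2 h1) _)
  intro t ht
  obtain ⟨G, -, rfl⟩ := Finset.mem_image.1 ht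
  exact Finset.mem_powerset.2 (Finset.sdiff_subset_sdiff (hedge G) le_rfl)

/-- The probability that a given injection is an induced embedding of `H` into `G(n,p)`,
in terms of a lower bound `m` on the number of edges of `H`. -/
lemma prob_embedding_le {V : Type*} [Fintype V] {n : ℕ} {p : ℝ} (h0 : 0 ≤ p) (h1 : p ≤ 1 / 2)
    (H : SimpleGraph V) {f : V → Fin n} (hf : Function.Injective f) {m : ℕ}
    (hm : m ≤ Nat.card H.edgeSet) :
    prob n p (fun G => ∀ u v, G.Adj (f u) (f v) ↔ H.Adj u v) ≤
      p ^ m * (1 - p) ^ ((Fintype.card V).choose 2 - m) := by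
  classical
  have hinj : Function.Injective (Sym2.map f) := Sym2.map.injective hf
  set A := (⊤ : SimpleGraph V).edgeFinset.image (Sym2.map f) with hA
  set B := H.edgeFinset.image (Sym2.map f) with hB
  have hBA : B ⊆ A := Finset.image_subset_image (SimpleGraph.edgeFinset_mono le_top)
  have hAcard : A.card = (Fintype.card V).choose 2 := by
    rw [hA, Finset.card_image_of_injective _ hinj,
      SimpleGraph.card_edgeFinset_top_eq_card_choose_two]
  have hBcard : m ≤ B.card := by
    rwa [hB, Finset.card_image_of_injective _ hinj, SimpleGraph.edgeFinset_card,
      ← Nat.card_eq_fintype_card]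
  have hle := Finset.card_le_card hBA
  have hprob : prob n p (fun G => ∀ u v, G.Adj (f u) (f v) ↔ H.Adj u v) ≤
      prob n p (fun G => ∀ e ∈ A, e ∈ G.edgeSet ↔ e ∈ B) := by
    refine prob_mono h0 (by linarith) fun G hG => ?_
    intro e he
    obtain ⟨e, -, rfl⟩ := Finset.mem_image.1 he
    rw [hB, Finset.mem_image]
    simp only [hinj.eq_iff, exists_eq_right, SimpleGraph.mem_edgeFinset]
    induction e with
    | _ u v => simpa using hG u v
  refine hprob.trans ((prob_cylinder_le h0 (by linarith) A B hBA ?_).trans ?_)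
  · intro e he
    obtain ⟨e, hmem, rfl⟩ := Finset.mem_image.1 he
    rw [SimpleGraph.mem_edgeFinset] at hmem
    rw [Sym2.isDiag_map hf]
    exact SimpleGraph.not_isDiag_of_mem_edgeSet _ hmem
  · obtain ⟨d, hd⟩ := Nat.exists_eq_add_of_le hBcard
    have hexp : (Fintype.card V).choose 2 - m = d + (A.card - B.card) := by omega
    rw [hexp, hd, pow_add, pow_add, mul_assoc]
    have hpow : p ^ d ≤ (1 - p) ^ d := pow_le_pow_left₀ h0 (by linarith) d
    have hq : 0 ≤ 1 - p := by linarith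
    gcongr

/-- First moment bound for the existence of an induced copy of `H`, given a lower bound `m`
on its number of edges and a family `σ` of distinct automorphisms. -/
lemma mul_prob_inducedCopy_le {V κ : Type} [Fintype V] [Fintype κ] {n : ℕ} {p : ℝ}
    (h0 : 0 ≤ p) (h1 : p ≤ 1 / 2) (H : SimpleGraph V) {m : ℕ} (hm : m ≤ Nat.card H.edgeSet)
    (σ : κ → H ≃g H) (hσ : Function.Injective σ) :
    Fintype.card κ * prob n p (fun G => ∃ s : Set (Fin n), IsInducedCopy H G s) ≤
      (n : ℝ) ^ Fintype.card V * (p ^ m * (1 - p) ^ ((Fintype.card V).choose 2 - m)) := by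
  classical
  refine (mul_prob_le_sum h0 (by linarith)
    (Finset.univ.filter fun f : V → Fin n => Function.Injective f) _
    (fun f G => ∀ u v, G.Adj (f u) (f v) ↔ H.Adj u v) _ ?_).trans ?_
  · rintro G ⟨s, ⟨φ⟩⟩
    have hinj : Function.Injective (fun k v => (φ (σ k v) : Fin n)) := fun k l hkl =>
      hσ (RelIso.ext fun v => φ.injective (Subtype.val_injective (congrFun hkl v)))
    refine ⟨Finset.univ.image fun k v => (φ (σ k v) : Fin n), ?_, ?_, ?_⟩
    · intro f hf
      obtain ⟨k, -, rfl⟩ := Finset.mem_image.1 hf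
      exact Finset.mem_filter.2 ⟨Finset.mem_univ _,
        Subtype.val_injective.comp (φ.injective.comp (σ k).injective)⟩
    · rw [Finset.card_image_of_injective _ hinj, Finset.card_univ]
    · intro f hf u v
      obtain ⟨k, -, rfl⟩ := Finset.mem_image.1 hf
      rw [← (σ k).map_adj_iff, ← φ.map_adj_iff]
      rfl
  · refine (Finset.sum_le_card_nsmul _ _ _ fun f hf =>
      prob_embedding_le h0 h1 H (Finset.mem_filter.1 hf).2 hm).trans ?_
    rw [nsmul_eq_mul]
    have hq : 0 ≤ 1 - p := by linarith
    refine mul_le_mul_of_nonneg_right ?_ (by positivity)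
    have := Finset.card_filter_le (Finset.univ : Finset (V → Fin n)) Function.Injective
    rw [Finset.card_univ, Fintype.card_fun, Fintype.card_fin] at this
    exact_mod_cast this

end FirstMoment

/-! ### The structure of `W_a^γ` -/

section Structure

lemma ωr_four_succ (a : ℕ) : ωr 4 (a + 1) = 4 * ωr 4 a + 1 := by
  have h : 4 ^ a % 3 = 1 := by simp [Nat.pow_mod]
  simp only [ωr, pow_succ]
  generalize 4 ^ a = t at *
  omega

lemma three_mul_ωr_four (a : ℕ) : 3 * ωr 4 a + 1 = 4 ^ a := by
  have h : 4 ^ a % 3 = 1 := by simp [Nat.pow_mod]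
  simp only [ωr]
  generalize 4 ^ a = t at *
  omega

lemma heapDepth_succ (r j : ℕ) : heapDepth r (j + 1) = heapDepth r (j / r) + 1 := by
  rw [heapDepth]

lemma heapDepth_lt {a i : ℕ} (h : i < ωr 4 a) : heapDepth 4 i < a := by
  induction a generalizing i with
  | zero => simp [ωr] at h
  | succ a ih =>
    rw [ωr_four_succ] at h
    cases i with
    | zero => simp [heapDepth]
    | succ j =>
      rw [heapDepth_succ]
      have := ih (i := j / 4) (by omega)
      omega

lemma card_WVert (γ a : ℕ) : Fintype.card (WVert γ a) = a + (γ + 1) * ωr 4 a := by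
  simp [WVert, mul_comm]

/-- Each pair `(i,k)` with `k < γ` is followed on its path by `(i,k+1)`, and `(i,γ)` by the
vertex of `F₁` at the depth of `i`. -/
def pathSucc (γ a : ℕ) (x : Fin (ωr 4 a) × Fin (γ + 1)) : WVert γ a :=
  if h : (x.2 : ℕ) < γ then .inr (x.1, ⟨x.2 + 1, by omega⟩)
  else .inl ⟨heapDepth 4 x.1, heapDepth_lt x.1.2⟩

/-- An enumeration of edges of `W_a^γ`. -/
def edgeEnum (γ a : ℕ) :
    Fin (a - 1) ⊕ (Fin (ωr 4 a - 1) ⊕ (Fin (ωr 4 a) × Fin (γ + 1))) → Sym2 (WVert γ a)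
  | .inl u => s(.inl ⟨u, by omega⟩, .inl ⟨u + 1, by omega⟩)
  | .inr (.inl i) => s(.inr (⟨i + 1, by omega⟩, 0), .inr (⟨i / 4, by omega⟩, 0))
  | .inr (.inr x) => s(.inr x, pathSucc γ a x)

lemma edgeEnum_mem (γ a : ℕ) (x) : edgeEnum γ a x ∈ (WG γ a).edgeSet := by
  rcases x with u | i | ⟨i, k⟩
  · simp [edgeEnum, WG, SimpleGraph.fromRel_adj, Wbase]
  · simp [edgeEnum, WG, SimpleGraph.fromRel_adj, Wbase]
    omega
  · by_cases h : (k : ℕ) < γ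
    · simp [edgeEnum, WG, SimpleGraph.fromRel_adj, Wbase, pathSucc, h]
      exact fun hk => absurd (congrArg Fin.val hk) (by simp)
    · have : (k : ℕ) = γ := by omega
      simp [edgeEnum, WG, SimpleGraph.fromRel_adj, Wbase, pathSucc, this]

lemma edgeEnum_injective (γ a : ℕ) : Function.Injective (edgeEnum γ a) := by
  rintro (u | i | ⟨i, k⟩) (u' | i' | ⟨i', k'⟩) h
  all_goals
    simp only [edgeEnum, pathSucc, Sym2.eq_iff] at h
    try split_ifs at h
    all_goals simp only [Sum.inl.injEq, Sum.inr.injEq, Prod.mk.injEq, Fin.ext_iff, reduceCtorEq,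
      Fin.val_zero, false_and, and_false, or_false] at h ⊢
    all_goals try omega

lemma le_card_edgeSet_WG (γ a : ℕ) :
    (a - 1) + ((ωr 4 a - 1) + (γ + 1) * ωr 4 a) ≤ Nat.card (WG γ a).edgeSet := by
  have h := Nat.card_le_card_of_injective
    (fun x => (⟨edgeEnum γ a x, edgeEnum_mem γ a x⟩ : (WG γ a).edgeSet))
    fun x y hxy => edgeEnum_injective γ a (congrArg Subtype.val hxy)
  simpa [mul_comm] using h

/-- The involution of the heap indices exchanging `4j+1` and `4j+2` for all `j ∈ T`. -/
def siblingSwap (T : Set ℕ) [DecidablePred (· ∈ T)] (i : ℕ) : ℕ :=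
  if i % 4 = 1 ∧ i / 4 ∈ T then i + 1
  else if i % 4 = 2 ∧ i / 4 ∈ T then i - 1 else i

variable (T : Set ℕ) [DecidablePred (· ∈ T)]

lemma siblingSwap_siblingSwap (i : ℕ) : siblingSwap T (siblingSwap T i) = i := by
  unfold siblingSwap
  by_cases hT : i / 4 ∈ T
  · by_cases h1 : i % 4 = 1
    · have : (i + 1) / 4 = i / 4 := by omega
      have : (i + 1) % 4 = 2 := by omega
      simp [*]
    · by_cases h2 : i % 4 = 2
      · have : (i - 1) / 4 = i / 4 := by omega
        have : (i - 1) % 4 = 1 := by omega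
        simp [*]
        omega
      · simp [h1, h2]
  · simp [hT]

lemma siblingSwap_parent (i : ℕ) :
    (siblingSwap T i = 0 ↔ i = 0) ∧ (siblingSwap T i - 1) / 4 = (i - 1) / 4 := by
  unfold siblingSwap
  split_ifs with h h
  · have := h.1
    exact ⟨⟨False.elim, by omega⟩, by omega⟩
  · have := h.1
    exact ⟨iff_of_false (by omega) (by omega), by omega⟩
  · exact ⟨Iff.rfl, rfl⟩

lemma heapDepth_siblingSwap (i : ℕ) : heapDepth 4 (siblingSwap T i) = heapDepth 4 i := by
  have ⟨h0, h⟩ := siblingSwap_parent T i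
  rcases Nat.eq_zero_or_pos i with rfl | hi
  · rw [h0.2 rfl]
  · obtain ⟨j, rfl⟩ := Nat.exists_eq_succ_of_ne_zero hi.ne'
    obtain ⟨k, hk⟩ := Nat.exists_eq_succ_of_ne_zero (mt h0.1 hi.ne')
    rw [hk] at h ⊢
    simp only [Nat.succ_eq_add_one, Nat.add_sub_cancel] at h
    simp only [Nat.succ_eq_add_one, heapDepth_succ, h]

variable {T}

lemma siblingSwap_lt {b i : ℕ} (hT : ∀ j ∈ T, j < ωr 4 b) (hi : i < ωr 4 (b + 1)) :
    siblingSwap T i < ωr 4 (b + 1) := by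
  rw [ωr_four_succ] at *
  unfold siblingSwap
  split_ifs with h h
  · have := hT _ h.2
    omega
  · omega
  · exact hi

lemma siblingSwap_eq_self {b i : ℕ} (hT : ∀ j ∈ T, ωr 4 b ≤ j) (hi : i < ωr 4 (b + 1)) :
    siblingSwap T i = i := by
  rw [ωr_four_succ] at hi
  unfold siblingSwap
  split_ifs with h h
  · have := hT _ h.2
    omega
  · have := hT _ h.2
    omega
  · rfl

/-- Exchanging leaves of `F₂` together with their attached paths. -/
def leafSwapFun (γ b : ℕ) (hT : ∀ j ∈ T, j < ωr 4 (b + 1)) : WVert γ (b + 2) → WVert γ (b + 2)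
  | .inl u => .inl u
  | .inr x => .inr (⟨siblingSwap T x.1, siblingSwap_lt hT x.1.2⟩, x.2)

lemma leafSwapFun_involutive (γ b : ℕ) (hT : ∀ j ∈ T, j < ωr 4 (b + 1)) :
    Function.Involutive (leafSwapFun γ b hT) := by
  rintro (u | ⟨i, k⟩)
  · rfl
  · simp [leafSwapFun, siblingSwap_siblingSwap]

lemma Wbase_leafSwapFun {γ b : ℕ} (hT : ∀ j ∈ T, j < ωr 4 (b + 1)) (hT' : ∀ j ∈ T, ωr 4 b ≤ j)
    {x y : WVert γ (b + 2)} (h : Wbase γ (b + 2) x y) :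
    Wbase γ (b + 2) (leafSwapFun γ b hT x) (leafSwapFun γ b hT y) := by
  rcases x with u | ⟨i, k⟩ <;> rcases y with v | ⟨j, l⟩
  · exact h
  · simpa [Wbase, leafSwapFun, heapDepth_siblingSwap] using h
  · exact h
  · simp only [Wbase, leafSwapFun] at h ⊢
    rcases h with ⟨rfl, h⟩ | ⟨hk, hl, hi, hj⟩
    · exact Or.inl ⟨rfl, h⟩
    · refine Or.inr ⟨hk, hl, ?_, ?_⟩
      · have := (siblingSwap_parent T i).1
        omega
      · have hj' : (j : ℕ) < ωr 4 (b + 1) := by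
          have := i.2.trans_eq (ωr_four_succ (b + 1))
          omega
        rw [(siblingSwap_parent T i).2, siblingSwap_eq_self hT' hj', hj]

lemma WG_adj_leafSwapFun {γ b : ℕ} (hT : ∀ j ∈ T, j < ωr 4 (b + 1)) (hT' : ∀ j ∈ T, ωr 4 b ≤ j)
    {x y : WVert γ (b + 2)} (h : (WG γ (b + 2)).Adj x y) :
    (WG γ (b + 2)).Adj (leafSwapFun γ b hT x) (leafSwapFun γ b hT y) := by
  rw [WG, SimpleGraph.fromRel_adj] at h ⊢
  exact ⟨(leafSwapFun_involutive γ b hT).injective.ne h.1,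
    h.2.imp (Wbase_leafSwapFun hT hT') (Wbase_leafSwapFun hT hT')⟩

/-- `leafSwapFun` as an automorphism of `W_{b+2}^γ`. -/
def leafSwap (γ b : ℕ) (hT : ∀ j ∈ T, j < ωr 4 (b + 1)) (hT' : ∀ j ∈ T, ωr 4 b ≤ j) :
    WG γ (b + 2) ≃g WG γ (b + 2) where
  toEquiv := (leafSwapFun_involutive γ b hT).toPerm
  map_rel_iff' := by
    intro x y
    refine ⟨fun h => ?_, WG_adj_leafSwapFun hT hT'⟩
    have := WG_adj_leafSwapFun hT hT' h
    simpa [leafSwapFun_involutive γ b hT _] using this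

/-- The automorphisms of `W_{b+2}^γ` indexed by the subsets of the set of nodes of `F₂` at
depth `b`. -/
def leafSwapFamily (γ b : ℕ) (S : Set (Fin (4 ^ b))) : WG γ (b + 2) ≃g WG γ (b + 2) :=
  open scoped Classical in
  leafSwap (T := {j | ∃ t ∈ S, j = ωr 4 b + t}) γ b
    (by
      rintro j ⟨t, -, rfl⟩
      have := three_mul_ωr_four b
      have := t.2
      rw [ωr_four_succ]
      omega)
    (by
      rintro j ⟨t, -, rfl⟩
      omega)

lemma leafSwapFamily_injective (γ b : ℕ) : Function.Injective (leafSwapFamily γ b) := by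
  classical
  intro S S' h
  ext t
  have hlt : 4 * (ωr 4 b + t) + 1 < ωr 4 (b + 2) := by
    have := three_mul_ωr_four b
    have := t.2
    rw [ωr_four_succ, ωr_four_succ]
    omega
  have h' := congrArg (fun φ : WG γ (b + 2) ≃g WG γ (b + 2) => φ (.inr (⟨_, hlt⟩, 0))) h
  have hdiv : (4 * (ωr 4 b + (t : ℕ)) + 1) / 4 = ωr 4 b + t := by omega
  have hmod : (4 * (ωr 4 b + (t : ℕ)) + 1) % 4 = 1 := by omega
  simp [leafSwapFamily, leafSwap, leafSwapFun, siblingSwap, hdiv, hmod, ← Fin.ext_iff] at h'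
  by_cases h1 : t ∈ S <;> by_cases h2 : t ∈ S' <;> simp_all

end Structure

/-! ### Asymptotic estimates -/

section Estimates

/-- The exponent in the first moment bound for `W_a^γ` (with `c = γ + 1`, `w` the number of
vertices of `F₂` and `M` the logarithmic number of automorphisms) is at most `-2 log n`. -/
lemma exponent_le {α c a w M L p v C : ℝ} (hα1 : α ≤ 1) (hc : 1 ≤ c)
    (ha : 0 ≤ a) (hw : 0 ≤ w) (hL : 0 ≤ L) (hp : 0 ≤ p) (hv : v = a + c * w) (haL : a ≤ 1 + L)
    (hvC : v ≤ C * M) (hM0 : 0 ≤ M) (hpC : 12 * C * p ≤ 1) (hM : L * (L + 5) ≤ M / 4)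
    (hpv : 2 * (1 - α * (c + 1) / c) * L ≤ p * v) :
    v * L - α * L * (a + (c + 1) * w - 2) -
        p * (v * (v - 1) / 2 - (a + (c + 1) * w - 2)) - M / 2 ≤ -2 * L := by
  have hc0 : 0 < c := by linarith
  have hv0 : 0 ≤ v := by rw [hv]; positivity
  have hquad : v * L - α * L * ((c + 1) * w + a + a / c) ≤ p * v * v / 2 := by
    have h1 := mul_le_mul_of_nonneg_right hpv hv0
    have h2 : 2 * (1 - α * (c + 1) / c) * L * v =
        2 * (v * L - α * L * ((c + 1) * w + a + a / c)) := by
      rw [hv]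
      field_simp
      ring
    linarith
  have hac : α * L * (a / c) ≤ L * (1 + L) := by
    have h1 : a / c ≤ 1 + L := (div_le_self ha hc).trans haL
    have h2 : α * L ≤ L := mul_le_of_le_one_left hL hα1
    exact mul_le_mul h2 h1 (by positivity) hL
  have hαL : α * L ≤ L := mul_le_of_le_one_left hL hα1
  have hlin : p * (v / 2 + (a + (c + 1) * w - 2)) ≤ M / 4 := by
    have h1 : v / 2 + (a + (c + 1) * w - 2) ≤ 3 * v := by
      have : w ≤ c * w := le_mul_of_one_le_left hw hc
      rw [hv]
      linarith
    have h2 := mul_le_mul_of_nonneg_left h1 hp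
    have h3 := mul_le_mul_of_nonneg_left hvC hp
    have h4 := mul_le_mul_of_nonneg_right hpC hM0
    linarith
  linarith

lemma kcoef_pos {α : ℝ} (hα : α < 1 / 2) (γ : ℕ) : 0 < kcoef α γ := by
  have hγ : (0 : ℝ) < γ + 1 := by positivity
  have : α * ((γ : ℝ) + 2) / (γ + 1) < 1 := by
    rw [div_lt_one hγ]
    have : (0 : ℝ) ≤ γ := by positivity
    nlinarith
  rw [kcoef]
  linarith

lemma cast_card_WVert (γ a : ℕ) :
    (Fintype.card (WVert γ a) : ℝ) = a + ((γ : ℝ) + 1) * ((4 : ℝ) ^ a - 1) / 3 := by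
  have h : 3 * (ωr 4 a : ℝ) + 1 = 4 ^ a := by exact_mod_cast three_mul_ωr_four a
  rw [card_WVert, ← h]
  push_cast
  ring

lemma card_WVert_le (γ b : ℕ) :
    Fintype.card (WVert γ (b + 2)) ≤ 16 * (γ + 2) * 4 ^ b := by
  have h1 := three_mul_ωr_four (b + 2)
  have h2 : b + 2 < 4 ^ (b + 2) := Nat.lt_pow_self (by norm_num)
  have h3 : 4 ^ (b + 2) = 16 * 4 ^ b := by ring
  have h4 : (γ + 1) * ωr 4 (b + 2) ≤ (γ + 1) * (16 * 4 ^ b) :=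
    Nat.mul_le_mul_left _ (by omega)
  rw [card_WVert]
  nlinarith

lemma depth_le_log {γ b n : ℕ} (h : Fintype.card (WVert γ (b + 2)) ≤ n) :
    (b : ℝ) + 1 ≤ Real.log n := by
  have h1 := three_mul_ωr_four (b + 2)
  have h2 : 4 ^ (b + 2) = 4 * 4 ^ (b + 1) := by ring
  have h3 : ωr 4 (b + 2) ≤ (γ + 1) * ωr 4 (b + 2) := Nat.le_mul_of_pos_left _ (by omega)
  have h4 : 4 ^ (b + 1) ≤ n := by
    have : 0 < 4 ^ (b + 1) := by positivity
    rw [card_WVert] at h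
    omega
  have hn : (0 : ℝ) < n := by
    have : 0 < 4 ^ (b + 1) := by positivity
    exact_mod_cast this.trans_le h4
  rw [Real.le_log_iff_exp_le hn]
  calc Real.exp (b + 1) = Real.exp 1 ^ (b + 1) := by
        rw [← Real.exp_nat_mul]
        push_cast
        ring_nf
    _ ≤ 4 ^ (b + 1) :=
        pow_le_pow_left₀ (Real.exp_pos 1).le (by linarith [Real.exp_one_lt_d9]) _
    _ ≤ n := by exact_mod_cast h4

/-- First moment bound for `W_{b+2}^γ`, in exponential form. -/
lemma prob_inducedCopy_WG_le_exp {α : ℝ} (γ b : ℕ) {n : ℕ} (hn : 0 < n)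
    (hp : (n : ℝ) ^ (-α) ≤ 1 / 2) :
    prob n ((n : ℝ) ^ (-α)) (fun G => ∃ s, IsInducedCopy (WG γ (b + 2)) G s) ≤
      Real.exp ((Fintype.card (WVert γ (b + 2)) : ℝ) * Real.log n -
        α * Real.log n * (((b + 2 : ℕ) : ℝ) + ((γ + 1 : ℝ) + 1) * ωr 4 (b + 2) - 2) -
        (n : ℝ) ^ (-α) * ((Fintype.card (WVert γ (b + 2)) : ℝ) *
          ((Fintype.card (WVert γ (b + 2)) : ℝ) - 1) / 2 -
          (((b + 2 : ℕ) : ℝ) + ((γ + 1 : ℝ) + 1) * ωr 4 (b + 2) - 2)) - (4 : ℝ) ^ b / 2) := by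
  have hn' : (0 : ℝ) < n := by exact_mod_cast hn
  have h := mul_prob_inducedCopy_le (n := n) (by positivity) hp (WG γ (b + 2))
    (le_card_edgeSet_WG γ (b + 2)) (leafSwapFamily γ b) (leafSwapFamily_injective γ b)
  set p := (n : ℝ) ^ (-α) with hpdef
  set v := Fintype.card (WVert γ (b + 2))
  set m := (b + 2 - 1) + ((ωr 4 (b + 2) - 1) + (γ + 1) * ωr 4 (b + 2)) with hm
  have hω : 1 ≤ ωr 4 (b + 2) := by
    rw [ωr_four_succ]
    omega
  have hmcast : ((b + 2 : ℕ) : ℝ) + ((γ + 1 : ℝ) + 1) * ωr 4 (b + 2) - 2 = m := by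
    rw [hm]
    push_cast [Nat.cast_sub hω]
    ring
  rw [hmcast, ← Nat.cast_choose_two ℝ v]
  have hp0 : 0 < p := Real.rpow_pos_of_pos hn' _
  have hcardκ : (Fintype.card (Set (Fin (4 ^ b))) : ℝ) = 2 ^ (4 ^ b) := by
    rw [Fintype.card_set, Fintype.card_fin]
    push_cast
    rfl
  have hpexp : p = Real.exp (-(α * Real.log n)) := by
    rw [hpdef, Real.rpow_def_of_pos hn']
    ring_nf
  have h2 : Real.exp ((4 : ℝ) ^ b / 2) ≤ 2 ^ (4 ^ b) := by
    rw [← Real.exp_log (show (0 : ℝ) < 2 by norm_num), ← Real.exp_nat_mul]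
    refine Real.exp_le_exp.2 ?_
    rw [Real.exp_log (show (0 : ℝ) < 2 by norm_num)]
    push_cast
    nlinarith [Real.log_two_gt_d9, show (0 : ℝ) < 4 ^ b by positivity]
  have hnpow : (n : ℝ) ^ v = Real.exp (v * Real.log n) := by
    rw [Real.exp_nat_mul, Real.exp_log hn']
  have hppow : p ^ m = Real.exp (-(α * Real.log n * m)) := by
    rw [hpexp, ← Real.exp_nat_mul]
    ring_nf
  have hqpow : (1 - p) ^ (v.choose 2 - m) ≤ Real.exp (-(p * (v.choose 2 - m))) := by
    calc (1 - p) ^ (v.choose 2 - m) ≤ Real.exp (-p) ^ (v.choose 2 - m) :=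
          pow_le_pow_left₀ (by linarith) (Real.one_sub_le_exp_neg p) _
      _ = Real.exp (-(p * ((v.choose 2 - m : ℕ) : ℝ))) := by
          rw [← Real.exp_nat_mul]
          ring_nf
      _ ≤ _ := Real.exp_le_exp.2 <| neg_le_neg <|
          mul_le_mul_of_nonneg_left (sub_le_iff_le_add.2 (by exact_mod_cast le_tsub_add)) hp0.le
  rw [hcardκ, hnpow, hppow] at h
  have hP := prob_nonneg hp0.le (by linarith : p ≤ 1)
    (fun G : SimpleGraph (Fin n) => ∃ s, IsInducedCopy (WG γ (b + 2)) G s)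
  have h3 := (mul_le_mul_of_nonneg_right h2 hP).trans (h.trans
    (mul_le_mul_of_nonneg_left (mul_le_mul_of_nonneg_left hqpow (Real.exp_pos _).le)
      (Real.exp_pos _).le))
  rw [← Real.exp_add, ← Real.exp_add, mul_comm, ← le_div_iff₀ (Real.exp_pos _),
    ← Real.exp_sub] at h3
  refine h3.trans_eq ?_
  ring_nf

/-- For large `n`, each single `W_a^γ` with at least `k_γ f(n)` and at most `n` vertices has
an induced copy with probability at most `n^{-2}`. -/
lemma prob_inducedCopy_WG_le {α : ℝ} (hα0 : 0 < α) (hα : α < 1 / 2) {γ a n : ℕ} (ha : 1 ≤ a)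
    (hn : 0 < n) (hp : 12 * (16 * ((γ : ℝ) + 2)) * (n : ℝ) ^ (-α) ≤ 1) (hL : 1 ≤ Real.log n)
    (hlog : 4 * (16 * ((γ : ℝ) + 2)) * (Real.log n + 5) ≤ kcoef α γ * (n : ℝ) ^ α)
    (hf : kcoef α γ * ff α n ≤ Fintype.card (WVert γ a))
    (hcard : Fintype.card (WVert γ a) ≤ n) :
    prob n ((n : ℝ) ^ (-α)) (fun G => ∃ s, IsInducedCopy (WG γ a) G s) ≤
      Real.exp (-2 * Real.log n) := by
  have hn' : (0 : ℝ) < n := by exact_mod_cast hn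
  have hγ : (0 : ℝ) ≤ γ := by positivity
  have hp0 : 0 < (n : ℝ) ^ (-α) := Real.rpow_pos_of_pos hn' _
  have hsize : 4 * (16 * ((γ : ℝ) + 2)) * (Real.log n * (Real.log n + 5)) ≤
      Fintype.card (WVert γ a) := by
    refine le_trans ?_ hf
    rw [ff]
    nlinarith
  obtain ⟨b, rfl⟩ : ∃ b, a = b + 2 := by
    refine Nat.exists_eq_add_of_le' ?_
    by_contra hlt
    obtain rfl : a = 1 := by omega
    have h1 : Fintype.card (WVert γ 1) = γ + 2 := by
      rw [card_WVert]
      simp [ωr]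
      ring
    rw [h1] at hsize
    push_cast at hsize
    have : 6 ≤ Real.log n * (Real.log n + 5) := by nlinarith
    nlinarith
  have hvC : (Fintype.card (WVert γ (b + 2)) : ℝ) ≤ 16 * ((γ : ℝ) + 2) * 4 ^ b := by
    exact_mod_cast card_WVert_le γ b
  refine (prob_inducedCopy_WG_le_exp γ b hn (by nlinarith)).trans (Real.exp_le_exp.2 ?_)
  refine exponent_le (C := 16 * ((γ : ℝ) + 2)) (by linarith) (by linarith) (by positivity)
    (by positivity) (by linarith) hp0.le ?_ ?_ hvC (by positivity) hp ?_ ?_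
  · rw [card_WVert]
    push_cast
    ring
  · have := depth_le_log hcard
    push_cast
    linarith
  · have h16 : (0 : ℝ) < 16 * (γ + 2) := by positivity
    refine le_of_mul_le_mul_left ?_ h16
    linarith
  · have h1 := mul_le_mul_of_nonneg_left hf hp0.le
    have h2 : (n : ℝ) ^ (-α) * (kcoef α γ * ff α n) = kcoef α γ * Real.log n := by
      have : (n : ℝ) ^ (-α) * (n : ℝ) ^ α = 1 := by
        rw [← Real.rpow_add hn']
        simp
      rw [ff]
      linear_combination (kcoef α γ * Real.log n) * this
    rw [h2, kcoef] at h1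
    rwa [show (γ : ℝ) + 1 + 1 = γ + 2 by ring]

lemma prob_exists_inducedCopy_le {α : ℝ} (hα0 : 0 < α) (hα : α < 1 / 2) {γ n : ℕ} {ε : ℝ}
    (hε : 0 < ε)
    (hn : 0 < n) (hp : 12 * (16 * ((γ : ℝ) + 2)) * (n : ℝ) ^ (-α) ≤ 1) (hL : 1 ≤ Real.log n)
    (hlog : 4 * (16 * ((γ : ℝ) + 2)) * (Real.log n + 5) ≤ kcoef α γ * (n : ℝ) ^ α) :
    prob n ((n : ℝ) ^ (-α)) (fun G =>
      ∃ a : ℕ, 1 ≤ a ∧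
        (a : ℝ) + ((γ : ℝ) + 1) * ((4 : ℝ) ^ a - 1) / 3 ≥ kcoef α γ * ff α n + ε ∧
        ∃ s : Set (Fin n), IsInducedCopy (WG γ a) G s) ≤ 2 * (n : ℝ)⁻¹ := by
  classical
  have hn' : (1 : ℝ) ≤ n := by exact_mod_cast hn
  have hγ : (0 : ℝ) ≤ γ := by positivity
  have hp0 : 0 < (n : ℝ) ^ (-α) := Real.rpow_pos_of_pos (by linarith) _
  have hp1 : (n : ℝ) ^ (-α) ≤ 1 := by nlinarith
  refine (prob_le_sum hp0.le hp1
    ((Finset.range (n + 1)).filter fun a => 1 ≤ a ∧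
      kcoef α γ * ff α n ≤ Fintype.card (WVert γ a) ∧ Fintype.card (WVert γ a) ≤ n) _
    (fun a G => ∃ s, IsInducedCopy (WG γ a) G s) ?_).trans ?_
  · rintro G ⟨a, ha, hsize, s, ⟨φ⟩⟩
    have hcard : Fintype.card (WVert γ a) ≤ n := by
      have := Fintype.card_le_of_injective (fun v => (φ v : Fin n))
        (Subtype.val_injective.comp φ.injective)
      rwa [Fintype.card_fin] at this
    have han : a ≤ n := by
      rw [card_WVert] at hcard
      omega
    refine ⟨a, Finset.mem_filter.2 ⟨Finset.mem_range.2 (by omega), ha, ?_, hcard⟩, s, ⟨φ⟩⟩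
    rw [cast_card_WVert]
    linarith
  · refine (Finset.sum_le_card_nsmul _ _ (Real.exp (-2 * Real.log n)) fun a ha => ?_).trans ?_
    · obtain ⟨-, ha1, hf, hcard⟩ := Finset.mem_filter.1 ha
      exact prob_inducedCopy_WG_le hα0 hα ha1 hn hp hL hlog hf hcard
    · have hexp : Real.exp (-2 * Real.log n) = (n : ℝ)⁻¹ * (n : ℝ)⁻¹ := by
        rw [show -2 * Real.log n = -Real.log n + -Real.log n by ring, Real.exp_add,
          Real.exp_neg, Real.exp_log (by linarith)]
      have hnum := (Finset.range (n + 1)).card_filter_le fun a => 1 ≤ a ∧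
        kcoef α γ * ff α n ≤ Fintype.card (WVert γ a) ∧ Fintype.card (WVert γ a) ≤ n
      rw [Finset.card_range] at hnum
      rw [nsmul_eq_mul, hexp]
      calc _ ≤ ((n + 1 : ℕ) : ℝ) * ((n : ℝ)⁻¹ * (n : ℝ)⁻¹) := by gcongr
        _ ≤ (2 * n) * ((n : ℝ)⁻¹ * (n : ℝ)⁻¹) := by
          gcongr
          push_cast
          linarith
        _ = 2 * (n : ℝ)⁻¹ := by field_simp

end Estimates

/-- Let α ∈ (0,1/2), γ ≥ 0 and ε > 0. Then the probability that G(n, n^{−α})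
contains an induced copy of W_a^γ for some a ≥ 1 with
a + (γ+1)(4^a−1)/3 ≥ k_γ·f(n) + ε tends to 0. -/
theorem stmt8 (α : ℝ) (hα0 : 0 < α) (hα : α < 1 / 2) (γ : ℕ) (ε : ℝ) (hε : 0 < ε) :
    Tendsto (fun n : ℕ =>
        prob n ((n : ℝ) ^ (-α)) (fun G =>
          ∃ a : ℕ, 1 ≤ a ∧
            (a : ℝ) + ((γ : ℝ) + 1) * ((4 : ℝ) ^ a - 1) / 3 ≥ kcoef α γ * ff α n + ε ∧
            ∃ s : Set (Fin n), IsInducedCopy (WG γ a) G s))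
      atTop (nhds 0) := by
  have hcast := tendsto_natCast_atTop_atTop (R := ℝ)
  have hk := kcoef_pos hα γ
  have hC : (0 : ℝ) < 16 * (γ + 2) := by positivity
  have hp : ∀ᶠ n : ℕ in atTop, 12 * (16 * ((γ : ℝ) + 2)) * (n : ℝ) ^ (-α) ≤ 1 := by
    have h := ((tendsto_rpow_neg_atTop hα0).comp hcast).const_mul (12 * (16 * ((γ : ℝ) + 2)))
    rw [mul_zero] at h
    exact h.eventually_le_const one_pos
  have hL : ∀ᶠ n : ℕ in atTop, 1 ≤ Real.log n :=
    (Real.tendsto_log_atTop.comp hcast).eventually_ge_atTop 1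
  have hlog : ∀ᶠ n : ℕ in atTop,
      4 * (16 * ((γ : ℝ) + 2)) * (Real.log n + 5) ≤ kcoef α γ * (n : ℝ) ^ α := by
    have hδ : 0 < kcoef α γ / (24 * (16 * ((γ : ℝ) + 2))) := by positivity
    have h := hcast.eventually ((isLittleO_log_rpow_atTop hα0).bound hδ)
    filter_upwards [h, hL] with n hn hL
    rw [Real.norm_of_nonneg (by linarith), Real.norm_of_nonneg (by positivity), div_mul_eq_mul_div,
      le_div_iff₀ (by positivity)] at hn
    nlinarith
  refine tendsto_of_tendsto_of_tendsto_of_le_of_le' tendsto_const_nhds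
    (g := fun _ => 0) (h := fun n : ℕ => 2 * (n : ℝ)⁻¹) ?_ ?_ ?_
  · simpa using (tendsto_inv_atTop_zero.comp hcast).const_mul (2 : ℝ)
  · filter_upwards [hp] with n hp
    refine prob_nonneg (by positivity) ?_ _
    have : (0 : ℝ) ≤ (n : ℝ) ^ (-α) := by positivity
    have : (0 : ℝ) ≤ γ := by positivity
    nlinarith
  · filter_upwards [hp, hL, hlog, eventually_gt_atTop 0] with n hp hL hlog hn
    exact prob_exists_inducedCopy_le hα0 hα hε hn hp hL hlog
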